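/- Let G be a finite abelian group whose order is an even number with |G| ≥ 36. Then every subset A of G \ {0} with |A| = cr(G) − 1 contains a complete subset, i.e., a nonempty subset A' ⊆ A with Σ(A') = ⟨A'⟩. -/

import Mathlib

open Finset

/-- The set of all nonempty subset sums of a finite set `A`. -/
def nss {G : Type*} [AddCommGroup G] [DecidableEq G] (A : Finset G) : Finset G :=
  (A.powerset.erase ∅).image fun B => B.sum id

/-- The critical number of a finite abelian group `G`. -/
noncomputable def cr (G : Type*) [AddCommGroup G] [Fintype G] [DecidableEq G] : ℕ :=
  sInf {ℓ : ℕ | 0 < ℓ ∧ ∀ A : Finset G, (0 : G) ∉ A → ℓ ≤ A.card → nss A = Finset.univ}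

section

open scoped Pointwise

/-- Olson: if `X + S` is small, it contains the cosets of `⟨S⟩` that meet `X`. -/
theorem add_mem_add_of_card_lt {G : Type*} [AddCommGroup G] [Finite G] [DecidableEq G] (m : ℕ) :
    ∀ (S X : Finset G), S.card = m → (0 : G) ∈ S → 2 * (X + S).card < 2 * X.card + S.card →
      ∀ x ∈ X, ∀ h ∈ AddSubgroup.closure (S : Set G), x + h ∈ X + S := by
  induction m using Nat.strong_induction_on with
  | _ m ih =>
  intro S X hm h0 hlt
  have hXsub : X ⊆ X + S := fun x hx => by simpa using add_mem_add hx h0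
  have hsd : 2 * ((X + S) \ X).card < S.card := by
    have := card_sdiff_add_card_eq_card hXsub
    omega
  -- for a point that `S` moves out of `X`, the returning part of `S` generates periods
  have key : ∀ x ∈ X, ∀ s ∈ S, x + s ∉ X → ∃ H : AddSubgroup G, ∃ P : Finset G,
      (P : Set G) ⊆ H ∧ S.card < 2 * P.card ∧ ∀ y, (y ∈ X ∨ y = x + s) → ∀ h ∈ H, y + h ∈ X + S := by
    intro x hx s hs hxs
    set S' := S.filter (fun t => x + t ∈ X) with hS'
    set V := (S.filter (fun t => x + t ∉ X)).image (fun t => x + t) with hV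
    have hVcard : V.card + S'.card = S.card := by
      rw [hV, card_image_of_injective _ (add_right_injective x), add_comm, hS']
      exact card_filter_add_card_filter_not (s := S) (fun t => x + t ∈ X)
    have hVX : Disjoint X V := by
      rw [Finset.disjoint_right]
      intro v hv
      obtain ⟨t, ht, rfl⟩ := mem_image.1 hv
      exact (mem_filter.1 ht).2
    have hVsub : V ⊆ (X + S) \ X := by
      intro v hv
      rw [mem_sdiff]
      refine ⟨?_, Finset.disjoint_right.1 hVX hv⟩
      obtain ⟨t, ht, rfl⟩ := mem_image.1 hv
      exact add_mem_add hx (mem_filter.1 ht).1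
    have hVle := card_le_card hVsub
    have hxsV : x + s ∈ V := mem_image.2 ⟨s, mem_filter.2 ⟨hs, hxs⟩, rfl⟩
    have hVpos : 0 < V.card := card_pos.2 ⟨_, hxsV⟩
    have hsub : (X ∪ V) + S' ⊆ X + S := by
      rintro y hy
      obtain ⟨a, ha, b, hb, rfl⟩ := mem_add.1 hy
      rcases mem_union.1 ha with ha | ha
      · exact add_mem_add ha (mem_filter.1 hb).1
      · obtain ⟨t, ht, rfl⟩ := mem_image.1 ha
        have : x + t + b = (x + b) + t := by abel
        rw [this]
        exact add_mem_add (mem_filter.1 hb).2 (mem_filter.1 ht).1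
    have hI := ih S'.card (by omega) S' (X ∪ V) rfl (mem_filter.2 ⟨h0, by simpa using hx⟩) (by
      have h1 := card_le_card hsub
      have h2 := card_union_of_disjoint hVX
      omega)
    refine ⟨AddSubgroup.closure (S' : Set G), S', AddSubgroup.subset_closure, by omega, ?_⟩
    rintro y hy h hh
    refine hsub (hI y ?_ h hh)
    rcases hy with hy | rfl
    · exact mem_union_left _ hy
    · exact mem_union_right _ hxsV
  -- a subgroup of periods that `S` preserves contains the whole generated subgroup
  have stable : ∀ H : AddSubgroup G, (∀ x ∈ X, ∀ s ∈ S, ∃ y ∈ X, x + s - y ∈ H) →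
      ∀ h ∈ AddSubgroup.closure (S : Set G), ∀ x ∈ X, ∃ y ∈ X, x + h - y ∈ H := by
    intro H hH h hh
    induction hh using AddSubgroup.closure_induction with
    | mem s hs => exact fun x hx => hH x hx s hs
    | zero => exact fun x hx => ⟨x, hx, by simp⟩
    | add a b _ _ iha ihb =>
      intro x hx
      obtain ⟨y, hy, hy'⟩ := iha x hx
      obtain ⟨z, hz, hz'⟩ := ihb y hy
      refine ⟨z, hz, ?_⟩
      have : x + (a + b) - z = (x + a - y) + (y + b - z) := by abel
      rw [this]
      exact H.add_mem hy' hz'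
    | neg a _ iha =>
      have hiter : ∀ n : ℕ, ∀ x ∈ X, ∃ y ∈ X, x + n • a - y ∈ H := by
        intro n
        induction n with
        | zero => exact fun x hx => ⟨x, hx, by simp⟩
        | succ n ihn =>
          intro x hx
          obtain ⟨y, hy, hy'⟩ := ihn x hx
          obtain ⟨z, hz, hz'⟩ := iha y hy
          refine ⟨z, hz, ?_⟩
          have : x + (n + 1) • a - z = (x + n • a - y) + (y + a - z) := by
            rw [succ_nsmul]; abel
          rw [this]
          exact H.add_mem hy' hz'
      have hneg : (addOrderOf a - 1) • a = -a := by
        rw [eq_neg_iff_add_eq_zero, ← succ_nsmul, Nat.sub_add_cancel (addOrderOf_pos a),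
          addOrderOf_nsmul_eq_zero]
      simpa [hneg] using hiter (addOrderOf a - 1)
  by_cases hall : ∀ x ∈ X, ∀ s ∈ S, x + s ∈ X
  · intro x hx h hh
    obtain ⟨y, hy, hy'⟩ := stable ⊥ (fun x hx s hs => ⟨x + s, hall x hx s hs, by simp⟩) h hh x hx
    have : x + h = y := by simpa [sub_eq_zero] using hy'
    exact this ▸ hXsub hy
  push Not at hall
  obtain ⟨x, hx, s, hs, hxs⟩ := hall
  obtain ⟨H, P, hPH, hP, hper⟩ := key x hx s hs hxs
  by_cases hst : ∀ x ∈ X, ∀ s ∈ S, ∃ y ∈ X, x + s - y ∈ H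
  · intro x hx h hh
    obtain ⟨y, hy, hy'⟩ := stable H hst h hh x hx
    simpa using hper y (Or.inl hy) _ hy'
  exfalso
  push Not at hst
  obtain ⟨x', hx', s', hs', hout⟩ := hst
  have hx's' : x' + s' ∉ X := fun h => hout _ h (by simp)
  obtain ⟨K, Q, hQK, hQ, hper'⟩ := key x' hx' s' hs' hx's'
  have hu : ∃ k ∈ K, x' + s' + k ∈ X := by
    by_contra! hno
    have : Q.image (fun k => x' + s' + k) ⊆ (X + S) \ X := by
      intro y hy
      obtain ⟨k, hk, rfl⟩ := mem_image.1 hy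
      exact mem_sdiff.2 ⟨hper' _ (Or.inr rfl) k (hQK hk), hno k (hQK hk)⟩
    have := card_le_card this
    rw [card_image_of_injective _ (add_right_injective _)] at this
    omega
  obtain ⟨k, hk, hu⟩ := hu
  classical
  let φ : G → G := fun h => if ∃ l ∈ K, x' + s' + h + l ∈ X then x' + s' + h else x' + s' + k + h
  have hφ : ∀ h ∈ H, φ h ∈ (X + S) \ X := by
    intro h hh
    rw [mem_sdiff]
    simp only [φ]
    split_ifs with hc
    · obtain ⟨l, hl, hc⟩ := hc
      refine ⟨by simpa using hper' _ (Or.inl hc) (-l) (K.neg_mem hl), fun hX => hout _ hX ?_⟩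
      have : x' + s' - (x' + s' + h) = -h := by abel
      rw [this]
      exact H.neg_mem hh
    · refine ⟨hper _ (Or.inl hu) h hh, fun hX => hc ⟨k, hk, ?_⟩⟩
      rwa [add_right_comm]
  have hcross : ∀ a ∈ H, ∀ b ∈ H, x' + s' + a ≠ x' + s' + k + b := by
    intro a ha b hb hab
    refine hout _ hu ?_
    have : x' + s' - (x' + s' + k) = b - a := by
      have : k = a - b := by
        rw [add_assoc (x' + s')] at hab
        rw [add_left_cancel hab]; abel
      rw [this]; abel
    rw [this]
    exact H.sub_mem hb ha
  have hinj : Set.InjOn φ P := by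
    intro a ha b hb hab
    simp only [φ] at hab
    split_ifs at hab
    · exact add_left_cancel hab
    · exact (hcross a (hPH ha) b (hPH hb) hab).elim
    · exact (hcross b (hPH hb) a (hPH ha) hab.symm).elim
    · exact add_left_cancel hab
  have h1 : (P.image φ).card ≤ ((X + S) \ X).card := by
    refine card_le_card fun y hy => ?_
    obtain ⟨p, hp, rfl⟩ := mem_image.1 hy
    exact hφ p (hPH hp)
  rw [card_image_of_injOn hinj] at h1
  omega

end

/-- The number of elements that translation by `x` moves out of `B`. -/
def shiftLoss {G : Type*} [AddCommGroup G] [DecidableEq G] (B : Finset G) (x : G) : ℕ :=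
  (B.filter fun b => b + x ∉ B).card

theorem shiftLoss_zero {G : Type*} [AddCommGroup G] [DecidableEq G] (B : Finset G) :
    shiftLoss B 0 = 0 := by
  simp [shiftLoss]

theorem shiftLoss_add_le {G : Type*} [AddCommGroup G] [DecidableEq G] (B : Finset G) (x y : G) :
    shiftLoss B (x + y) ≤ shiftLoss B x + shiftLoss B y := by
  unfold shiftLoss
  rw [← card_image_of_injective (B.filter fun b => b + y ∉ B) (sub_left_injective (b := x))]
  refine (card_le_card ?_).trans (card_union_le _ _)
  intro b hb
  obtain ⟨hb, hb'⟩ := mem_filter.1 hb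
  rw [mem_union]
  by_cases h : b + x ∈ B
  · right
    exact mem_image.2 ⟨b + x, mem_filter.2 ⟨h, by rwa [add_assoc]⟩, by simp⟩
  · left
    exact mem_filter.2 ⟨hb, h⟩

theorem shiftLoss_compl {G : Type*} [AddCommGroup G] [Fintype G] [DecidableEq G] (B : Finset G)
    (x : G) : shiftLoss Bᶜ x = shiftLoss B x := by
  unfold shiftLoss
  have h1 := card_filter_add_card_filter_not (s := B) (fun b => b + x ∈ B)
  have h2 := card_filter_add_card_filter_not (s := (univ : Finset G).filter (fun b => b + x ∈ B))
    (fun b => b ∈ B)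
  have h3 : ((univ : Finset G).filter (fun b => b + x ∈ B)).card = B.card := by
    rw [← card_image_of_injective _ (add_left_injective x)]
    congr 1
    ext b
    simp only [mem_image, mem_filter, mem_univ, true_and]
    exact ⟨fun ⟨a, ha, h⟩ => h ▸ ha, fun h => ⟨b - x, by simpa using h, by simp⟩⟩
  have h4 : (Bᶜ.filter fun b => b + x ∉ Bᶜ) =
      ((univ : Finset G).filter (fun b => b + x ∈ B)).filter (fun b => b ∉ B) := by
    ext b; simp [and_comm]
  have h5 : (B.filter fun b => b + x ∈ B) =
      ((univ : Finset G).filter (fun b => b + x ∈ B)).filter (fun b => b ∈ B) := by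
    ext b; simp [and_comm]
  rw [h4]
  rw [h5] at h1
  omega

theorem le_sum_shiftLoss {G : Type*} [AddCommGroup G] [DecidableEq G] (B T : Finset G)
    (h0 : (0 : G) ∉ T) : B.card * (T.card + 1) ≤ ∑ x ∈ T, shiftLoss B x + B.card * B.card := by
  have h1 : ∀ x, shiftLoss B x + ∑ b ∈ B, (if b + x ∈ B then 1 else 0) = B.card := by
    intro x
    rw [← card_filter, add_comm]
    exact card_filter_add_card_filter_not (s := B) (fun b => b + x ∈ B)
  have h2 : ∑ x ∈ T, ∑ b ∈ B, (if b + x ∈ B then 1 else 0) ≤ B.card * (B.card - 1) := by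
    rw [sum_comm]
    refine sum_le_card_nsmul _ _ _ fun b hb => ?_
    rw [← card_filter, ← card_erase_of_mem hb,
      ← card_image_of_injective _ (add_right_injective b)]
    refine card_le_card fun y hy => ?_
    obtain ⟨x, hx, rfl⟩ := mem_image.1 hy
    obtain ⟨hx, hx'⟩ := mem_filter.1 hx
    refine mem_erase.2 ⟨fun h => h0 ?_, hx'⟩
    rwa [← add_eq_left.1 h]
  have h3 : ∑ x ∈ T, shiftLoss B x + ∑ x ∈ T, ∑ b ∈ B, (if b + x ∈ B then 1 else 0)
      = T.card * B.card := by
    rw [← sum_add_distrib, sum_congr rfl fun x _ => h1 x]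
    simp
  have h4 : B.card * (B.card - 1) + B.card = B.card * B.card := by
    cases B.card <;> simp; ring
  nlinarith

open scoped Pointwise in
/-- If every element of a generating set moves few elements of `B` out of `B`, then so do many
elements of the group. -/
theorem card_shiftLoss_le {G : Type*} [AddCommGroup G] [Fintype G] [DecidableEq G]
    (B R : Finset G) (hR : AddSubgroup.closure (R : Set G) = ⊤) (hR0 : (0 : G) ∉ R) (t h : ℕ)
    (hh : 2 * h ≤ R.card + 1) (ht : ∀ x ∈ R, shiftLoss B x ≤ t) (j : ℕ) :
    univ.filter (fun x : G => shiftLoss B x ≤ t * (j + 1)) = univ ∨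
      h * (j + 2) ≤ (univ.filter (fun x : G => shiftLoss B x ≤ t * (j + 1))).card := by
  have hS : ∀ s ∈ insert 0 R, shiftLoss B s ≤ t := by
    intro s hs
    rcases mem_insert.1 hs with rfl | hs
    · simp [shiftLoss_zero]
    · exact ht s hs
  have hScard : (insert 0 R).card = R.card + 1 := card_insert_of_notMem hR0
  induction j with
  | zero =>
    right
    have : insert 0 R ⊆ univ.filter (fun x : G => shiftLoss B x ≤ t * (0 + 1)) := by
      intro s hs
      simpa using hS s hs
    have := card_le_card this
    omega
  | succ j ih =>
    set X := univ.filter (fun x : G => shiftLoss B x ≤ t * (j + 1)) with hX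
    set Y := univ.filter (fun x : G => shiftLoss B x ≤ t * (j + 1 + 1)) with hY
    have hXY : X + insert 0 R ⊆ Y := by
      intro y hy
      obtain ⟨a, ha, b, hb, rfl⟩ := mem_add.1 hy
      have h1 := (mem_filter.1 ha).2
      have h2 := hS b hb
      refine mem_filter.2 ⟨mem_univ _, (shiftLoss_add_le B a b).trans ?_⟩
      rw [mul_add t (j + 1) 1]
      omega
    by_cases hlt : 2 * (X + insert 0 R).card < 2 * X.card + (insert 0 R).card
    · left
      have h0 : (0 : G) ∈ X := by simp [hX, shiftLoss_zero]
      refine eq_univ_of_forall fun g => hXY ?_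
      have hg : g ∈ AddSubgroup.closure ((insert 0 R : Finset G) : Set G) := by
        have hg : g ∈ AddSubgroup.closure (R : Set G) := by simp [hR]
        exact AddSubgroup.closure_mono (by simp) hg
      simpa using add_mem_add_of_card_lt _ (insert 0 R) X rfl (mem_insert_self _ _) hlt 0 h0 g hg
    · have hle := card_le_card hXY
      rcases ih with ih | ih
      · left
        refine eq_univ_of_forall fun g => hXY ?_
        rw [ih]
        exact mem_add.2 ⟨g, mem_univ _, 0, mem_insert_self _ _, by simp⟩
      · right
        have : h * (j + 1 + 2) = h * (j + 2) + h := by ring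
        omega

theorem exists_sum_shiftLoss_le {G : Type*} [AddCommGroup G] [Fintype G] [DecidableEq G]
    (B R : Finset G) (hR : AddSubgroup.closure (R : Set G) = ⊤) (hR0 : (0 : G) ∉ R) (t h : ℕ)
    (hpos : 0 < h) (hh : 2 * h ≤ R.card + 1) (ht : ∀ x ∈ R, shiftLoss B x ≤ t) (k : ℕ)
    (hk : k < Fintype.card G) :
    ∃ T : Finset G, T.card = k ∧ (0 : G) ∉ T ∧
      ∑ x ∈ T, shiftLoss B x ≤ t * ∑ i ∈ range k, max 1 ((i + 1) / h) := by
  induction k with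
  | zero => exact ⟨∅, by simp⟩
  | succ k ih =>
    obtain ⟨T, hTc, hT0, hT⟩ := ih (by omega)
    set j := max 1 ((k + 1) / h) with hj
    have hj1 : 1 ≤ j := le_max_left _ _
    have hjk : (k + 1) / h ≤ j := le_max_right _ _
    obtain ⟨j, hj'⟩ := Nat.exists_eq_add_of_le' hj1
    have hcard : k + 2 ≤ (univ.filter (fun x : G => shiftLoss B x ≤ t * (j + 1))).card := by
      rcases card_shiftLoss_le B R hR hR0 t h hh ht j with hu | hu
      · rw [hu, card_univ]; omega
      · have h1 := Nat.lt_mul_div_succ (k + 1) hpos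
        have h2 : h * ((k + 1) / h + 1) ≤ h * (j + 2) := Nat.mul_le_mul_left _ (by omega)
        omega
    obtain ⟨x, hx, hxT⟩ := exists_mem_notMem_of_card_lt_card
      (s := insert 0 T) (t := univ.filter (fun x : G => shiftLoss B x ≤ t * (j + 1))) (by
        rw [card_insert_of_notMem hT0]; omega)
    rw [mem_insert, not_or] at hxT
    refine ⟨insert x T, by rw [card_insert_of_notMem hxT.2, hTc], ?_, ?_⟩
    · rw [mem_insert, not_or]
      exact ⟨fun h => hxT.1 h.symm, hT0⟩
    · rw [sum_insert hxT.2, sum_range_succ, mul_add, ← hj, hj', add_comm]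
      exact Nat.add_le_add hT (mem_filter.1 hx).2

theorem exists_lt_shiftLoss {G : Type*} [AddCommGroup G] [Fintype G] [DecidableEq G]
    (B R : Finset G) (hR : AddSubgroup.closure (R : Set G) = ⊤) (hR0 : (0 : G) ∉ R) (t h : ℕ)
    (hpos : 0 < h) (hh : 2 * h ≤ R.card + 1) (hB0 : 0 < B.card)
    (hB : 2 * B.card ≤ Fintype.card G)
    (hnum : t * ∑ i ∈ range (2 * B.card - 1), max 1 ((i + 1) / h) < B.card * B.card) :
    ∃ x ∈ R, t < shiftLoss B x := by
  by_contra! hno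
  obtain ⟨T, hTc, hT0, hT⟩ :=
    exists_sum_shiftLoss_le B R hR hR0 t h hpos hh hno (2 * B.card - 1) (by omega)
  have h1 := le_sum_shiftLoss B T hT0
  rw [hTc, Nat.sub_add_cancel (by omega)] at h1
  nlinarith

theorem sum_max_div_six_le (k : ℕ) (hk : 11 ≤ k) :
    12 * ∑ i ∈ range k, max 1 ((i + 1) / 6) ≤ k * (k + 1) := by
  induction k, hk using Nat.le_induction with
  | base => decide
  | succ k hk ih =>
    rw [sum_range_succ, mul_add]
    have : 12 * max 1 ((k + 1) / 6) ≤ 2 * (k + 1) := by omega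
    nlinarith

/-- A generating set with at least eleven elements contains an element that moves at least four
elements of `B` out of `B`. -/
theorem exists_four_le_shiftLoss {G : Type*} [AddCommGroup G] [Fintype G] [DecidableEq G]
    (B R : Finset G) (hR : AddSubgroup.closure (R : Set G) = ⊤) (hR0 : (0 : G) ∉ R)
    (hRc : 11 ≤ R.card) (hB : 6 ≤ B.card) (hB' : B.card + 6 ≤ Fintype.card G) :
    ∃ x ∈ R, 4 ≤ shiftLoss B x := by
  have main : ∀ B : Finset G, 6 ≤ B.card → 2 * B.card ≤ Fintype.card G →
      ∃ x ∈ R, 4 ≤ shiftLoss B x := by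
    intro B hB hB2
    refine exists_lt_shiftLoss B R hR hR0 3 6 (by norm_num) (by omega) (by omega) hB2 ?_
    have h1 := sum_max_div_six_le (2 * B.card - 1) (by omega)
    obtain ⟨b, hb⟩ : ∃ b, B.card = b + 1 := ⟨B.card - 1, by omega⟩
    rw [hb] at h1 ⊢
    have : 2 * (b + 1) - 1 = 2 * b + 1 := by omega
    rw [this] at h1 ⊢
    nlinarith
  by_cases h : 2 * B.card ≤ Fintype.card G
  · exact main B hB h
  · have hc := card_compl B
    obtain ⟨x, hx, hx'⟩ := main Bᶜ (by omega) (by omega)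
    exact ⟨x, hx, by rwa [shiftLoss_compl] at hx'⟩

theorem exists_five_le_shiftLoss {G : Type*} [AddCommGroup G] [Fintype G] [DecidableEq G]
    (B R : Finset G) (hR : AddSubgroup.closure (R : Set G) = ⊤) (hR0 : (0 : G) ∉ R)
    (hRc : 13 ≤ R.card) (hB : B.card = 14) (hB' : 28 ≤ Fintype.card G) :
    ∃ x ∈ R, 5 ≤ shiftLoss B x := by
  refine exists_lt_shiftLoss B R hR hR0 4 7 (by norm_num) (by omega) (by omega) (by omega) ?_
  rw [hB]
  decide

/-- More than half of a subgroup spans it. -/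
theorem nss_eq_of_card {G : Type*} [AddCommGroup G] [Finite G] [DecidableEq G] (D : Finset G)
    (H : AddSubgroup G) (hDH : (D : Set G) ⊆ H) (hD : Nat.card H + 3 ≤ 2 * D.card) (g : G)
    (hg : g ∈ H) : ∃ C ⊆ D, C.Nonempty ∧ C.sum id = g := by
  classical
  have := Fintype.ofFinite G
  set K : Finset G := univ.filter (· ∈ H) with hK
  have hKc : K.card = Nat.card H := by
    rw [Nat.card_eq_fintype_card, Fintype.card_subtype]
  have inter : ∀ E ⊆ D, ∀ y ∈ H, 2 * E.card ≤ K.card + (E.filter fun a => y - a ∈ E).card := by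
    intro E hE y hy
    have h1 : E.image (fun a => y - a) ∪ E ⊆ K := by
      intro a ha
      rw [hK, mem_filter]
      refine ⟨mem_univ _, ?_⟩
      rcases mem_union.1 ha with ha | ha
      · obtain ⟨b, hb, rfl⟩ := mem_image.1 ha
        exact H.sub_mem hy (hDH (hE hb))
      · exact hDH (hE ha)
    have h2 := card_union_add_card_inter (E.image (fun a => y - a)) E
    have h3 : E.image (fun a => y - a) ∩ E ⊆ E.filter fun a => y - a ∈ E := by
      intro a ha
      obtain ⟨ha, ha'⟩ := mem_inter.1 ha
      obtain ⟨b, hb, rfl⟩ := mem_image.1 ha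
      exact mem_filter.2 ⟨ha', by simpa using hb⟩
    rw [card_image_of_injective _ (sub_right_injective (b := y))] at h2
    have := card_le_card h1
    have := card_le_card h3
    omega
  by_cases hpair : ∃ a ∈ D, g - a ∈ D ∧ g - a ≠ a
  · obtain ⟨a, ha, hb, hab⟩ := hpair
    refine ⟨{a, g - a}, ?_, ⟨a, by simp⟩, ?_⟩
    · intro x hx
      rcases mem_insert.1 hx with rfl | hx
      · exact ha
      · rwa [mem_singleton.1 hx]
    · rw [sum_pair hab.symm]; simp
  push Not at hpair
  have hF := inter D subset_rfl g hg
  obtain ⟨p, hp, q, hq, hpq⟩ := one_lt_card.1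
    (show 1 < (D.filter fun a => g - a ∈ D).card by omega)
  have hp2 := hpair p (mem_filter.1 hp).1 (mem_filter.1 hp).2
  have hq2 := hpair q (mem_filter.1 hq).1 (mem_filter.1 hq).2
  by_contra hno
  -- otherwise every `g - d` is a double, and doubling is not injective
  have hdouble : ∀ d ∈ D, ∃ b ∈ D, g - d = b + b := by
    intro d hd
    have hE := inter (D.erase d) (erase_subset _ _) (g - d) (H.sub_mem hg (hDH hd))
    rw [card_erase_of_mem hd] at hE
    obtain ⟨b, hb⟩ := card_pos.1
      (show 0 < ((D.erase d).filter fun a => g - d - a ∈ D.erase d).card by omega)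
    obtain ⟨hb, hb'⟩ := mem_filter.1 hb
    obtain ⟨hb1, hb2⟩ := mem_erase.1 hb
    obtain ⟨hc1, hc2⟩ := mem_erase.1 hb'
    refine ⟨b, hb2, ?_⟩
    by_contra hne
    refine hno ⟨{d, b, g - d - b}, ?_, ⟨d, by simp⟩, ?_⟩
    · intro x hx
      simp only [mem_insert, mem_singleton] at hx
      rcases hx with rfl | rfl | rfl <;> assumption
    · have hbc : b ≠ g - d - b := fun h => hne (by rw [← sub_eq_iff_eq_add]; exact h.symm)
      rw [sum_insert, sum_pair hbc]
      · simp
      · simp only [mem_insert, mem_singleton, not_or]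
        exact ⟨fun h => hb1 h.symm, fun h => hc1 h.symm⟩
  choose! f hfD hf using hdouble
  have h2e : (p - q) + (p - q) = 0 := by
    have : (p - q) + (p - q) = (p - (g - p)) - (q - (g - q)) := by abel
    rw [this, hp2, hq2]; simp
  have hinj : Set.InjOn f D := by
    intro a ha b hb hab
    have h1 := hf a ha
    rw [hab, ← hf b hb] at h1
    exact sub_right_injective h1
  have hdisj : Disjoint (D.image f) (D.image fun d => f d + (p - q)) := by
    rw [Finset.disjoint_left]
    intro y hy hy'
    obtain ⟨a, ha, rfl⟩ := mem_image.1 hy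
    obtain ⟨b, hb, hab⟩ := mem_image.1 hy'
    have hab2 : g - a = g - b := by
      rw [hf a ha, hf b hb, ← hab]
      have : f b + (p - q) + (f b + (p - q)) = f b + f b + ((p - q) + (p - q)) := by abel
      rw [this, h2e, add_zero]
    obtain rfl : a = b := sub_right_injective hab2
    exact hpq (sub_eq_zero.1 (add_eq_left.1 hab))
  have hsub : D.image f ∪ D.image (fun d => f d + (p - q)) ⊆ K := by
    intro y hy
    rw [hK, mem_filter]
    refine ⟨mem_univ _, ?_⟩
    rcases mem_union.1 hy with hy | hy <;> obtain ⟨a, ha, rfl⟩ := mem_image.1 hy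
    · exact hDH (hfD a ha)
    · exact H.add_mem (hDH (hfD a ha))
        (H.sub_mem (hDH (mem_filter.1 hp).1) (hDH (mem_filter.1 hq).1))
  have h1 := card_le_card hsub
  rw [card_union_of_disjoint hdisj, card_image_of_injOn hinj,
    card_image_of_injOn (fun a ha b hb hab => hinj ha hb (add_right_cancel hab))] at h1
  omega

/-- The set of all subset sums of `C`, including the empty one. -/
def subsetSums {G : Type*} [AddCommGroup G] [DecidableEq G] (C : Finset G) : Finset G :=
  C.powerset.image fun B => B.sum id

theorem subsetSums_empty {G : Type*} [AddCommGroup G] [DecidableEq G] :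
    subsetSums (∅ : Finset G) = {0} := by
  simp [subsetSums]

theorem subsetSums_insert {G : Type*} [AddCommGroup G] [DecidableEq G] (C : Finset G) (z : G)
    (hz : z ∉ C) :
    subsetSums (insert z C) = subsetSums C ∪ (subsetSums C).image fun b => b + z := by
  unfold subsetSums
  rw [powerset_insert, image_union, image_image, image_image]
  congr 1
  refine image_congr fun B hB => ?_
  have : z ∉ B := fun h => hz (mem_powerset.1 hB h)
  simp [sum_insert this, add_comm]

theorem card_subsetSums_insert {G : Type*} [AddCommGroup G] [DecidableEq G] (C : Finset G) (z : G)
    (hz : z ∉ C) :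
    (subsetSums (insert z C)).card = (subsetSums C).card + shiftLoss (subsetSums C) z := by
  rw [subsetSums_insert C z hz, shiftLoss, ← union_sdiff_self_eq_union,
    card_union_of_disjoint disjoint_sdiff,
    ← card_image_of_injective ((subsetSums C).filter _) (add_left_injective z)]
  congr 2
  ext g
  simp only [mem_sdiff, mem_image, mem_filter]
  constructor
  · rintro ⟨⟨b, hb, rfl⟩, h⟩
    exact ⟨b, ⟨hb, h⟩, rfl⟩
  · rintro ⟨b, ⟨hb, h⟩, rfl⟩
    exact ⟨⟨b, hb, rfl⟩, h⟩

theorem shiftLoss_eq_card {G : Type*} [AddCommGroup G] [DecidableEq G] (B : Finset G) (z : G)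
    (h : ∀ b ∈ B, b + z ∉ B) : shiftLoss B z = B.card := by
  rw [shiftLoss, filter_true_of_mem h]

/-- The sum of the elements among `x`, `y`, `z` selected by `u`. -/
def cubeSum {G : Type*} [AddCommGroup G] (x y z : G) (u : Bool × Bool × Bool) : G :=
  (if u.1 then x else 0) + (if u.2.1 then y else 0) + (if u.2.2 then z else 0)

/-- The number of coordinates where `u` and `v` differ. -/
def cubeDist (u v : Bool × Bool × Bool) : ℕ :=
  (if u.1 = v.1 then 0 else 1) + (if u.2.1 = v.2.1 then 0 else 1) +
    (if u.2.2 = v.2.2 then 0 else 1)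

theorem two_le_cubeDist {G : Type*} [AddCommGroup G] (x y z : G) (u v : Bool × Bool × Bool)
    (w : G) (hw : cubeSum x y z v - cubeSum x y z u = w)
    (hne : w ≠ 0 ∧ w ≠ x ∧ w ≠ -x ∧ w ≠ y ∧ w ≠ -y ∧ w ≠ z ∧ w ≠ -z) : 2 ≤ cubeDist u v := by
  obtain ⟨a, b, c⟩ := u
  obtain ⟨a', b', c'⟩ := v
  obtain ⟨h0, h1, h2, h3, h4, h5, h6⟩ := hne
  have hd : ∀ (d d' : Bool) (g : G), w = (if d' then g else 0) - (if d then g else 0) →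
      w = 0 ∨ w = g ∨ w = -g := by
    intro d d' g
    cases d <;> cases d' <;> simp +contextual
  by_contra hf
  have hcase : (b = b' ∧ c = c') ∨ (a = a' ∧ c = c') ∨ (a = a' ∧ b = b') := by
    simp only [cubeDist] at hf
    by_cases h1 : a = a' <;> by_cases h2 : b = b' <;> by_cases h3 : c = c' <;>
      simp [h1, h2, h3] at hf ⊢
  simp only [cubeSum] at hw
  rcases hcase with ⟨rfl, rfl⟩ | ⟨rfl, rfl⟩ | ⟨rfl, rfl⟩
  · rcases hd a a' x (by rw [← hw]; abel) with h | h | h <;> contradiction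
  · rcases hd b b' y (by rw [← hw]; abel) with h | h | h <;> contradiction
  · rcases hd c c' z (by rw [← hw]; abel) with h | h | h <;> contradiction

theorem exists_six_le_shiftLoss {G : Type*} [AddCommGroup G] [DecidableEq G] (x y z : G)
    (B R : Finset G) (hB : B.card = 8) (hR : 11 ≤ R.card)
    (hcube : ∀ g ∈ B, ∃ u, cubeSum x y z u = g)
    (hne : ∀ w ∈ R, w ≠ 0 ∧ w ≠ x ∧ w ≠ -x ∧ w ≠ y ∧ w ≠ -y ∧ w ≠ z ∧ w ≠ -z) :
    ∃ w ∈ R, 6 ≤ shiftLoss B w := by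
  by_contra! hno
  set P : Finset ((Bool × Bool × Bool) × (Bool × Bool × Bool)) :=
    univ.filter fun p => cubeSum x y z p.2 - cubeSum x y z p.1 ∈ R with hP
  have hcount : ((univ : Finset ((Bool × Bool × Bool) × (Bool × Bool × Bool))).filter
      fun p => 2 ≤ cubeDist p.1 p.2).card = 32 := by
    decide
  have hle : P.card ≤ 32 := by
    rw [← hcount]
    exact card_le_card fun p hp => mem_filter.2 ⟨mem_univ _,
      two_le_cubeDist x y z p.1 p.2 _ rfl (hne _ (mem_filter.1 hp).2)⟩
  have hge : R.card * 3 ≤ P.card := by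
    have hmaps : Set.MapsTo (fun p : (Bool × Bool × Bool) × (Bool × Bool × Bool) =>
        cubeSum x y z p.2 - cubeSum x y z p.1) P R := fun p hp => (mem_filter.1 hp).2
    rw [card_eq_sum_card_fiberwise hmaps, ← smul_eq_mul]
    refine card_nsmul_le_sum _ _ _ fun w hw => ?_
    have h1 := hno w hw
    have h2 := card_filter_add_card_filter_not (s := B) (fun b => b + w ∈ B)
    unfold shiftLoss at h1
    refine (show 3 ≤ (B.filter fun b => b + w ∈ B).card by omega).trans
      ((card_le_card ?_).trans (card_image_le
        (f := fun p : (Bool × Bool × Bool) × (Bool × Bool × Bool) => cubeSum x y z p.1)))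
    intro b hb
    obtain ⟨hb, hb'⟩ := mem_filter.1 hb
    obtain ⟨u, rfl⟩ := hcube _ hb
    obtain ⟨v, hv⟩ := hcube _ hb'
    have hvu : cubeSum x y z v - cubeSum x y z u = w := by rw [hv]; simp
    refine mem_image.2 ⟨(u, v), ?_, rfl⟩
    simp only [hP, mem_filter, mem_univ, true_and]
    exact ⟨hvu ▸ hw, hvu⟩
  omega

theorem exists_card_four {G : Type*} [AddCommGroup G] [DecidableEq G] (A : Finset G)
    (hA0 : (0 : G) ∉ A) (hA : 17 ≤ A.card) :
    ∃ C ⊆ A, C.card = 4 ∧ 14 ≤ (subsetSums C).card := by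
  have avoid : ∀ F : Finset G, F.card < 17 → ∃ a ∈ A, a ∉ F := fun F hF =>
    exists_mem_notMem_of_card_lt_card (by omega)
  have hne : ∀ a ∈ A, a ≠ 0 := fun a ha h => hA0 (h ▸ ha)
  obtain ⟨x, hx, -⟩ := avoid ∅ (by simp)
  obtain ⟨y, hy, hyF⟩ := avoid {x, -x} (card_le_two.trans_lt (by norm_num))
  obtain ⟨z, hz, hzF⟩ := avoid {x, -x, y, -y, x + y, -(x + y), x - y, y - x}
    (Nat.lt_of_le_of_lt ((card_insert_le _ _).trans (Nat.succ_le_succ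
      ((card_insert_le _ _).trans (Nat.succ_le_succ card_le_six)))) (by norm_num))
  have hx0 := hne x hx
  have hy0 := hne y hy
  have hz0 := hne z hz
  simp only [mem_insert, mem_singleton, not_or] at hyF hzF
  obtain ⟨hyx, hynx⟩ := hyF
  obtain ⟨hz1, hz2, hz3, hz4, hz5, hz6, hz7, hz8⟩ := hzF
  set C : Finset G := insert z (insert y (insert x ∅)) with hC
  have hyC : y ∉ insert x (∅ : Finset G) := by simpa using hyx
  have hzC : z ∉ insert y (insert x (∅ : Finset G)) := by simp [hz1, hz3]
  have e1 : subsetSums (insert x (∅ : Finset G)) = {0, x} := by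
    rw [subsetSums_insert _ _ (by simp), subsetSums_empty]
    ext g; simp
  have e2 : subsetSums (insert y (insert x (∅ : Finset G))) = {0, x, y, x + y} := by
    rw [subsetSums_insert _ _ hyC, e1]
    ext g; simp; tauto
  have e3 : subsetSums C = {0, x, y, x + y, z, x + z, y + z, x + y + z} := by
    rw [subsetSums_insert _ _ hzC, e2]
    ext g; simp; tauto
  have c1 : ({0, x} : Finset G).card = 2 := card_pair (Ne.symm hx0)
  have c2 : (subsetSums (insert y (insert x (∅ : Finset G)))).card = 4 := by
    rw [card_subsetSums_insert _ _ hyC, e1, shiftLoss_eq_card, c1]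
    intro b hb hb'
    simp only [mem_insert, mem_singleton] at hb hb'
    rcases hb with rfl | rfl <;> rcases hb' with h | h
    · exact hy0 (by simpa using h)
    · exact hyx (by simpa using h)
    · exact hynx (eq_neg_of_add_eq_zero_right h)
    · exact hy0 (by simpa using h)
  have c3 : (subsetSums C).card = 8 := by
    rw [card_subsetSums_insert _ _ hzC, shiftLoss_eq_card, c2]
    rw [e2]
    intro b hb hb'
    simp only [mem_insert, mem_singleton] at hb hb'
    have hz' : ∀ {b b' : G}, b + z = b' → z = b' - b := fun h => by rw [← h]; simp
    rcases hb with rfl | rfl | rfl | rfl <;> rcases hb' with h | h | h | h <;>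
      replace h := hz' h <;> (try simp only [sub_self, sub_zero, zero_sub, add_sub_cancel_left,
        add_sub_cancel_right, sub_add_cancel_left, sub_add_cancel_right] at h) <;>
      contradiction
  set N : Finset G := {x, -x, y, -y, z, -z} with hN
  have hNc : N.card ≤ 6 := card_le_six
  have hBφ : ∀ g ∈ subsetSums C, ∃ u, cubeSum x y z u = g := by
    rw [e3]
    intro g hg
    simp only [mem_insert, mem_singleton] at hg
    rcases hg with rfl | rfl | rfl | rfl | rfl | rfl | rfl | rfl
    · exact ⟨(false, false, false), by simp [cubeSum]⟩
    · exact ⟨(true, false, false), by simp [cubeSum]⟩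
    · exact ⟨(false, true, false), by simp [cubeSum]⟩
    · exact ⟨(true, true, false), by simp [cubeSum]⟩
    · exact ⟨(false, false, true), by simp [cubeSum]⟩
    · exact ⟨(true, false, true), by simp [cubeSum]⟩
    · exact ⟨(false, true, true), by simp [cubeSum]⟩
    · exact ⟨(true, true, true), by simp [cubeSum]⟩
  have hRc : 11 ≤ (A \ N).card := by
    have := le_card_sdiff N A
    omega
  obtain ⟨w, hw, hw6⟩ := exists_six_le_shiftLoss x y z (subsetSums C) (A \ N) c3 hRc hBφ
    fun w hw => by
      obtain ⟨hwA, hwN⟩ := mem_sdiff.1 hw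
      simp only [hN, mem_insert, mem_singleton, not_or] at hwN
      exact ⟨hne w hwA, hwN⟩
  obtain ⟨hwA, hwN⟩ := mem_sdiff.1 hw
  have hwC : w ∉ C := by
    intro h
    apply hwN
    simp only [hC, mem_insert, notMem_empty, or_false] at h
    rcases h with rfl | rfl | rfl <;> simp [hN]
  refine ⟨insert w C, ?_, ?_, ?_⟩
  · intro g hg
    simp only [hC, mem_insert, notMem_empty, or_false] at hg
    rcases hg with rfl | rfl | rfl | rfl <;> assumption
  · rw [card_insert_of_notMem hwC, hC, card_insert_of_notMem hzC, card_insert_of_notMem hyC]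
    simp
  · rw [card_subsetSums_insert _ _ hwC]
    omega

theorem nss_subset_closure {G : Type*} [AddCommGroup G] [DecidableEq G] (A : Finset G) :
    (nss A : Set G) ⊆ AddSubgroup.closure (A : Set G) := by
  intro g hg
  obtain ⟨B, hB, rfl⟩ := mem_image.1 (mem_coe.1 hg)
  exact AddSubgroup.sum_mem _ fun b hb =>
    AddSubgroup.subset_closure (mem_powerset.1 (mem_erase.1 hB).2 hb)

theorem mem_nss {G : Type*} [AddCommGroup G] [DecidableEq G] {A : Finset G} {g : G} :
    g ∈ nss A ↔ ∃ C ⊆ A, C.Nonempty ∧ C.sum id = g := by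
  simp only [nss, mem_image, mem_erase, mem_powerset, nonempty_iff_ne_empty]
  exact ⟨fun ⟨C, h, e⟩ => ⟨C, h.2, h.1, e⟩, fun ⟨C, h, h', e⟩ => ⟨C, ⟨h', h⟩, e⟩⟩

/-- A nonempty set contained in a subgroup that it spans is complete. -/
theorem complete_of_forall_mem_nss {G : Type*} [AddCommGroup G] [DecidableEq G] (A : Finset G)
    (H : AddSubgroup G) (hAH : (A : Set G) ⊆ H) (h : ∀ g ∈ H, g ∈ nss A) :
    (nss A : Set G) = AddSubgroup.closure (A : Set G) := by
  refine (nss_subset_closure A).antisymm fun g hg => ?_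
  exact h g ((AddSubgroup.closure_le H).2 hAH hg)

theorem exists_index_eq_two {G : Type*} [AddCommGroup G] [Fintype G]
    (heven : Even (Fintype.card G)) : ∃ H : AddSubgroup G, H.index = 2 := by
  have hD : (nsmulAddMonoidHom 2 : G →+ G).range ≠ ⊤ := by
    intro h
    have hinj := Finite.injective_iff_surjective.2 (AddMonoidHom.range_eq_top.1 h)
    have : Fact (Nat.Prime 2) := ⟨Nat.prime_two⟩
    obtain ⟨g, hg⟩ := exists_prime_addOrderOf_dvd_card' (G := G) 2
      (by rw [Nat.card_eq_fintype_card]; exact heven.two_dvd)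
    have h2 : 2 • g = 0 := hg ▸ addOrderOf_nsmul_eq_zero g
    have : g = 0 := hinj (by simpa using h2)
    rw [this, addOrderOf_zero] at hg
    omega
  obtain ⟨H, hH, hle⟩ := (eq_top_or_exists_le_coatom _).resolve_left hD
  have hdbl : ∀ g : G, g + g ∈ H := fun g => hle ⟨g, by simp [two_nsmul]⟩
  obtain ⟨a, ha⟩ := SetLike.exists_not_mem_of_ne_top H hH.1
  have htop : H ⊔ AddSubgroup.zmultiples a = ⊤ := hH.2 _ (by
    refine lt_of_le_of_ne le_sup_left fun h => ha ?_
    rw [h]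
    exact AddSubgroup.mem_sup_right (AddSubgroup.mem_zmultiples a))
  refine ⟨H, AddSubgroup.index_eq_two_iff.2 ⟨a, fun b => ?_⟩⟩
  have hsplit : b ∈ H ∨ b + a ∈ H := by
    obtain ⟨h, hh, k, hk, rfl⟩ := AddSubgroup.mem_sup.1 (htop ▸ AddSubgroup.mem_top b)
    obtain ⟨n, rfl⟩ := AddSubgroup.mem_zmultiples_iff.1 hk
    rcases Int.even_or_odd' n with ⟨m, rfl | rfl⟩
    · left
      have : h + (2 * m) • a = h + m • (a + a) := by
        rw [← two_zsmul, ← mul_zsmul, mul_comm]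
      rw [this]
      exact H.add_mem hh (H.zsmul_mem (hdbl a) m)
    · right
      have : h + (2 * m + 1) • a + a = h + (m + 1) • (a + a) := by
        rw [← two_zsmul, ← mul_zsmul, add_assoc, ← add_one_zsmul]
        congr 2
        ring
      rw [this]
      exact H.add_mem hh (H.zsmul_mem (hdbl a) (m + 1))
  rcases hsplit with hb | hb
  · exact Or.inr ⟨hb, fun hba => ha (by simpa using H.sub_mem hba hb)⟩
  · exact Or.inl ⟨hb, fun hb' => ha (by simpa using H.sub_mem hb hb')⟩

theorem half_card_le_cr {G : Type*} [AddCommGroup G] [Fintype G] [DecidableEq G]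
    (heven : Even (Fintype.card G)) : Fintype.card G / 2 ≤ cr G := by
  classical
  have hne : {ℓ : ℕ | 0 < ℓ ∧ ∀ A : Finset G, (0 : G) ∉ A → ℓ ≤ A.card →
      nss A = Finset.univ}.Nonempty :=
    ⟨Fintype.card G + 1, by omega, fun A _ h => by have := card_le_univ A; omega⟩
  have hmem := (Nat.sInf_mem hne).2
  obtain ⟨H, hH⟩ := exists_index_eq_two heven
  have hcard := H.card_mul_index
  rw [hH, Nat.card_eq_fintype_card (α := G)] at hcard
  by_contra! hlt
  set A : Finset G := (univ.filter (· ∈ H)).erase 0 with hA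
  have hAc : A.card = Nat.card H - 1 := by
    rw [hA, card_erase_of_mem (by simp), Nat.card_eq_fintype_card, Fintype.card_subtype]
  have huniv := hmem A (by simp [hA]) (by unfold cr at hlt; omega)
  have hAH : (A : Set G) ⊆ H := by
    intro a ha
    exact (mem_filter.1 (mem_erase.1 (mem_coe.1 ha)).2).2
  have htop : H = ⊤ := by
    rw [eq_top_iff]
    intro g _
    have : g ∈ nss A := huniv ▸ mem_univ g
    exact (AddSubgroup.closure_le H).2 hAH (nss_subset_closure A this)
  rw [htop, AddSubgroup.index_top] at hH
  omega

/-- In a group of even order at least 36, every set of `|G| / 2 - 1` nonzero elements contains a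
complete subset. -/
theorem exists_complete {G : Type*} [AddCommGroup G] [Fintype G] [DecidableEq G]
    (N : ℕ) (hN : Fintype.card G = 2 * N) (hN18 : 18 ≤ N) (A : Finset G) (hA0 : (0 : G) ∉ A)
    (hA : A.card = N - 1) :
    ∃ A' : Finset G, A' ⊆ A ∧ A'.Nonempty ∧
      (nss A' : Set G) = (AddSubgroup.closure (A' : Set G) : Set G) := by
  by_contra hno
  have gen : ∀ R ⊆ A, N + 3 ≤ 2 * R.card → AddSubgroup.closure (R : Set G) = ⊤ := by
    intro R hR hRc
    by_contra hne
    refine hno ⟨R, hR, card_pos.1 (by omega), ?_⟩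
    refine complete_of_forall_mem_nss R _ AddSubgroup.subset_closure fun g hg => mem_nss.2 ?_
    refine nss_eq_of_card R _ AddSubgroup.subset_closure ?_ g hg
    have h1 := (AddSubgroup.closure (R : Set G)).card_mul_index
    have h2 : (AddSubgroup.closure (R : Set G)).index ≠ 1 := fun h =>
      hne (AddSubgroup.index_eq_one.1 h)
    rw [Nat.card_eq_fintype_card (α := G), hN] at h1
    have h3 : (AddSubgroup.closure (R : Set G)).index ≠ 0 := fun h => by
      rw [h] at h1; omega
    have h4 : 2 ≤ (AddSubgroup.closure (R : Set G)).index := by omega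
    have := Nat.mul_le_mul_left (Nat.card (AddSubgroup.closure (R : Set G))) h4
    omega
  have many : ∀ C ⊆ A, (subsetSums C).card + (A \ C).card ≤ 2 * N := by
    intro C hC
    by_contra! hlt
    refine hno ⟨A, subset_rfl, card_pos.1 (by omega), ?_⟩
    refine complete_of_forall_mem_nss A ⊤ (by simp) fun g _ => mem_nss.2 ?_
    have hnd : ¬ Disjoint ((subsetSums C).image fun b => g - b) (A \ C) := by
      intro hd
      have h1 := card_union_of_disjoint hd
      rw [card_image_of_injective _ (sub_right_injective (b := g))] at h1
      have h2 := card_le_univ (((subsetSums C).image fun b => g - b) ∪ A \ C)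
      omega
    rw [Finset.not_disjoint_iff] at hnd
    obtain ⟨a, ha, haC⟩ := hnd
    obtain ⟨b, hb, rfl⟩ := mem_image.1 ha
    obtain ⟨D, hD, rfl⟩ := mem_image.1 hb
    obtain ⟨haA, haC⟩ := mem_sdiff.1 haC
    have hDC := mem_powerset.1 hD
    refine ⟨insert (g - D.sum id) D, ?_, insert_nonempty _ _, ?_⟩
    · exact insert_subset haA (hDC.trans hC)
    · rw [sum_insert fun h => haC (hDC h)]
      simp
  have extend : ∀ C ⊆ A, ∀ k, (∃ x ∈ A \ C, k ≤ shiftLoss (subsetSums C) x) →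
      ∃ C' ⊆ A, C'.card = C.card + 1 ∧ (subsetSums C).card + k ≤ (subsetSums C').card := by
    rintro C hC k ⟨x, hx, hk⟩
    obtain ⟨hxA, hxC⟩ := mem_sdiff.1 hx
    refine ⟨insert x C, insert_subset hxA hC, card_insert_of_notMem hxC, ?_⟩
    rw [card_subsetSums_insert C x hxC]
    omega
  have four : ∀ C ⊆ A, 4 ≤ C.card → 3 * C.card ≤ N + 2 → 6 ≤ (subsetSums C).card →
      ∃ x ∈ A \ C, 4 ≤ shiftLoss (subsetSums C) x := by
    intro C hC hC4 hCN hB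
    have hR := card_sdiff_add_card_eq_card hC
    have hm := many C hC
    exact exists_four_le_shiftLoss _ _ (gen _ sdiff_subset (by omega))
      (fun h => hA0 (mem_sdiff.1 h).1) (by omega) hB (by omega)
  have grow : ∀ c, 5 ≤ c → 3 * c ≤ N + 5 →
      ∃ C ⊆ A, C.card = c ∧ 4 * c ≤ (subsetSums C).card + 1 := by
    intro c hc hcN
    induction c, hc using Nat.le_induction with
    | base =>
      obtain ⟨C, hC, hCc, hC14⟩ := exists_card_four A hA0 (by omega)
      have hR := card_sdiff_add_card_eq_card hC
      rcases hC14.eq_or_lt with h14 | h14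
      · obtain ⟨C', hC', h1, h2⟩ := extend C hC 5 <|
          exists_five_le_shiftLoss _ _ (gen _ sdiff_subset (by omega))
            (fun h => hA0 (mem_sdiff.1 h).1) (by omega) h14.symm (by omega)
        exact ⟨C', hC', by omega, by omega⟩
      · obtain ⟨C', hC', h1, h2⟩ := extend C hC 4 (four C hC (by omega) (by omega) (by omega))
        exact ⟨C', hC', by omega, by omega⟩
    | succ c hc ih =>
      obtain ⟨C, hC, hCc, hB⟩ := ih (by omega)
      obtain ⟨C', hC', h1, h2⟩ := extend C hC 4 (four C hC (by omega) (by omega) (by omega))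
      exact ⟨C', hC', by omega, by omega⟩
  obtain ⟨C, hC, hCc, hB⟩ := grow ((N + 5) / 3) (by omega) (by omega)
  have hR := card_sdiff_add_card_eq_card hC
  have hm := many C hC
  omega

theorem stmt2 {G : Type*} [AddCommGroup G] [Fintype G] [DecidableEq G]
    (heven : Even (Fintype.card G)) (hG : 36 ≤ Fintype.card G)
    (A : Finset G) (hA0 : (0 : G) ∉ A) (hcard : A.card = cr G - 1) :
    ∃ A' : Finset G, A' ⊆ A ∧ A'.Nonempty ∧
      (nss A' : Set G) = (AddSubgroup.closure (A' : Set G) : Set G) := by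
  obtain ⟨N, hN⟩ := heven.two_dvd
  have hcr := half_card_le_cr heven
  obtain ⟨A₀, hA₀, hA₀c⟩ := exists_subset_card_eq (s := A) (n := N - 1) (by omega)
  obtain ⟨A', hA', h⟩ := exists_complete N hN (by omega) A₀ (fun h => hA0 (hA₀ h)) hA₀c
  exact ⟨A', hA'.trans hA₀, h⟩
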